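/- arXiv:2001.06709 — 2 statements merged into one kernel-verified Lean document; each statement's English description precedes it below -/
import Mathlib

section
/- Let A be a k-algebra whose center is exactly the base field k. Then A is universally Morita cancellative; that is, for every finitely generated commutative domain R over k equipped with an ideal I ⊂ R such that the composite k → R → R/I is an isomorphism, and for every k-algebra B, any Morita equivalence between A ⊗_k R and B ⊗_k R implies that A and B are Morita equivalent. -/
open scoped TensorProduct

universe u

/-- The polynomial extension `A[t₁,…,tₙ]` of a (possibly noncommutative) `k`-algebra `A`
in `n` central, mutually commuting indeterminates. -/
abbrev PolyExt (A : Type u) [Ring A] (n : ℕ) : Type u :=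
  AddMonoidAlgebra A (Fin n →₀ ℕ)

/-- The canonical embedding `A → A[t₁,…,tₙ]` as constant polynomials. -/
noncomputable def PolyExt.C (k A : Type u) [Field k] [Ring A] [Algebra k A] (n : ℕ) :
    A →ₐ[k] PolyExt A n :=
  AddMonoidAlgebra.singleZeroAlgHom

/-- The `i`-th indeterminate of `A[t₁,…,tₙ]`. -/
noncomputable def PolyExt.X (A : Type u) [Ring A] (n : ℕ) (i : Fin n) : PolyExt A n :=
  AddMonoidAlgebra.single (Finsupp.single i 1) 1

/-- Two rings are Morita equivalent if their categories of right modules are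
equivalent (as abelian categories). -/
def MoritaEquivalent (R S : Type u) [Ring R] [Ring S] : Prop :=
  Nonempty (ModuleCat.{u} Rᵐᵒᵖ ≌ ModuleCat.{u} Sᵐᵒᵖ)

/-- `A` is strongly cancellative: for every `n ≥ 1` and every `k`-algebra `B`, any
`k`-algebra isomorphism `A[s₁,…,sₙ] ≅ B[t₁,…,tₙ]` implies `A ≅ B`. -/
def StronglyCancellative (k A : Type u) [Field k] [Ring A] [Algebra k A] : Prop :=
  ∀ (n : ℕ), 1 ≤ n → ∀ (B : Type u) [Ring B] [Algebra k B],
    Nonempty (PolyExt A n ≃ₐ[k] PolyExt B n) → Nonempty (A ≃ₐ[k] B)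

/-- `A` is strongly Morita cancellative: for every `n ≥ 1` and every `k`-algebra `B`,
Morita equivalence of `A[s₁,…,sₙ]` and `B[t₁,…,tₙ]` implies Morita equivalence of `A` and `B`. -/
def StronglyMoritaCancellative (k A : Type u) [Field k] [Ring A] [Algebra k A] : Prop :=
  ∀ (n : ℕ), 1 ≤ n → ∀ (B : Type u) [Ring B] [Algebra k B],
    MoritaEquivalent (PolyExt A n) (PolyExt B n) → MoritaEquivalent A B

/-- `A` is strongly retractable: every `k`-algebra isomorphism
`φ : A[s₁,…,sₙ] → B[t₁,…,tₙ]` (with `n ≥ 1`) satisfies `φ(A) = B`. -/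
def StronglyRetractable (k A : Type u) [Field k] [Ring A] [Algebra k A] : Prop :=
  ∀ (n : ℕ), 1 ≤ n → ∀ (B : Type u) [Ring B] [Algebra k B]
    (φ : PolyExt A n ≃ₐ[k] PolyExt B n),
    φ '' Set.range (PolyExt.C k A n) = Set.range (PolyExt.C k B n)

/-- `A` is strongly detectable: for every `k`-algebra isomorphism
`φ : A[s₁,…,sₙ] → B[t₁,…,tₙ]` (with `n ≥ 1`), the subalgebra of `B[t₁,…,tₙ]` generated by
`B` together with `φ(s₁),…,φ(sₙ)` is all of `B[t₁,…,tₙ]`. -/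
def StronglyDetectable (k A : Type u) [Field k] [Ring A] [Algebra k A] : Prop :=
  ∀ (n : ℕ), 1 ≤ n → ∀ (B : Type u) [Ring B] [Algebra k B]
    (φ : PolyExt A n ≃ₐ[k] PolyExt B n),
    Algebra.adjoin k
      (Set.range (PolyExt.C k B n) ∪ Set.range fun i => φ (PolyExt.X A n i)) = ⊤

open Polynomial in
/-- A subfield of a finitely generated `F`-domain with an `F`-rational point lies in `F`. -/
theorem exists_algebraMap_eq_of_field_ringHom {F S L : Type*} [Field F] [CommRing S] [IsDomain S]
    [Algebra F S] [Algebra.FiniteType F S] (π : S →ₐ[F] F) [Field L] (j : L →+* S) (l : L) :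
    ∃ c : F, algebraMap F S c = j l := by
  by_cases hf : IsIntegral F (j l)
  · have hroot : (minpoly F (j l)).IsRoot (π (j l)) := by
      have := congrArg π (minpoly.aeval F (j l))
      rwa [map_zero, ← Polynomial.aeval_algHom_apply, coe_aeval_eq_eval] at this
    exact minpoly.degree_eq_one_iff.mp
      (degree_eq_one_of_irreducible_of_root (minpoly.irreducible hf) hroot)
  exfalso
  have htr : Transcendental F (j l) := fun h => hf h.isIntegral
  algebraize [(aeval (R := F) (j l)).toRingHom]
  have : IsScalarTower F F[X] S := IsScalarTower.of_algebraMap_eq fun c => by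
    simp [RingHom.algebraMap_toAlgebra]
  have hinj : Function.Injective (algebraMap F[X] S) :=
    transcendental_iff_injective.mp htr
  have : FaithfulSMul F[X] S := (faithfulSMul_iff_algebraMap_injective _ _).mpr hinj
  have : Algebra.FiniteType F[X] S := Algebra.FiniteType.of_restrictScalars_finiteType F F[X] S
  have : Algebra.FinitePresentation F[X] S :=
    Algebra.FinitePresentation.of_finiteType.mp inferInstance
  have : Module.IsTorsionFree F[X] S := inferInstance
  have : Module.Flat F[X] S := inferInstance
  have hopen : IsOpen (Set.range (PrimeSpectrum.comap (algebraMap F[X] S))) :=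
    (PrimeSpectrum.isOpenMap_comap_of_hasGoingDown_of_finitePresentation).isOpen_range
  have hbot : PrimeSpectrum.comap (algebraMap F[X] S) ⊥ ∈
    Set.range (PrimeSpectrum.comap (algebraMap F[X] S)) := ⟨_, rfl⟩
  obtain ⟨_, ⟨_, ⟨a, rfl⟩, rfl⟩, ha, hsub⟩ :=
    PrimeSpectrum.isBasis_basic_opens.exists_subset_of_mem_open hbot hopen
  have ha0 : a ≠ 0 := by
    rintro rfl
    simp at ha
  obtain ⟨n, hn, hnF⟩ : ∃ n : ℕ, a.natDegree < n ∧ (n : F) ≠ 0 := by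
    by_cases h : ((a.natDegree + 1 : ℕ) : F) = 0
    · refine ⟨a.natDegree + 1 + 1, by omega, ?_⟩
      rw [Nat.cast_succ, h]
      simp
    · exact ⟨_, Nat.lt_succ_self _, h⟩
  have hn0 : 0 < n := by omega
  set h : F[X] := X ^ n - 1
  have hdeg : h.natDegree = n := by
    simpa using natDegree_X_pow_sub_C (n := n) (r := (1 : F))
  have hsep : h.Separable := X_pow_sub_one_separable_iff.mpr hnF
  have himg : algebraMap F[X] S h = j (l ^ n - 1) := by
    simp [RingHom.algebraMap_toAlgebra, h]
  have hunit : IsUnit (algebraMap F[X] S h) := by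
    rw [himg]
    refine (IsUnit.mk0 _ fun h0 => ?_).map j
    rw [h0, map_zero, map_eq_zero_iff _ hinj] at himg
    exact hsep.ne_zero himg
  have hrad : a ∈ (Ideal.span {h}).radical := by
    rw [Ideal.radical_eq_sInf, Ideal.mem_sInf]
    rintro q ⟨hq, hqp⟩
    by_contra haq
    obtain ⟨Q, hQ⟩ := hsub (show (⟨q, hqp⟩ : PrimeSpectrum F[X]) ∈ PrimeSpectrum.basicOpen a
      from haq)
    refine Q.2.ne_top (Ideal.eq_top_of_isUnit_mem _ ?_ hunit)
    have : h ∈ (PrimeSpectrum.comap (algebraMap F[X] S) Q).asIdeal := by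
      rw [hQ]
      exact hq (Ideal.mem_span_singleton_self h)
    exact this
  obtain ⟨m, hm⟩ := hrad
  have hdvd : h ∣ a := hsep.squarefree.isRadical m a (Ideal.mem_span_singleton.mp hm)
  have := natDegree_le_of_dvd hdvd ha0
  omega

/-- Integral extensions do not raise the Krull dimension. -/
theorem ringKrullDim_le_of_isIntegral (R S : Type*) [CommRing R] [CommRing S] [Algebra R S]
    [Algebra.IsIntegral R S] : ringKrullDim S ≤ ringKrullDim R :=
  Order.krullDim_le_of_strictMono (PrimeSpectrum.comap (algebraMap R S)) fun p q hpq => by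
    obtain ⟨hle, x, hx, hx'⟩ := Set.ssubset_iff_exists.mp
      (show (p.asIdeal : Set S) ⊂ q.asIdeal from hpq)
    exact Ideal.comap_lt_comap_of_integral_mem_sdiff hpq.le ⟨hx, hx'⟩
      (Algebra.IsIntegral.isIntegral x)

theorem ringKrullDim_eq_of_isIntegral_of_injective (R S : Type*) [CommRing R] [CommRing S]
    [Algebra R S] [Algebra.IsIntegral R S] (h : Function.Injective (algebraMap R S)) :
    ringKrullDim S = ringKrullDim R := by
  refine le_antisymm (ringKrullDim_le_of_isIntegral R S) (iSup_le fun l => ?_)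
  obtain ⟨Q, -, hQ, hQ'⟩ := Ideal.exists_ideal_over_prime_of_isIntegral l.head.asIdeal (⊥ : Ideal S)
    (by rw [Ideal.comap_bot_of_injective _ h]; exact bot_le)
  have : Q.LiesOver l.head.asIdeal := ⟨hQ'.symm⟩
  obtain ⟨L, hL, -⟩ := Ideal.exists_ltSeries_of_hasGoingUp (S := S) l Q
  rw [← hL]
  exact le_iSup (fun l : LTSeries (PrimeSpectrum S) => (l.length : WithBot ℕ∞)) L

/-- If `Z ⊗ R ≃ R` for a finitely generated `k`-domain `R`, then `Z` is a field. -/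
theorem isField_of_ringEquiv_tensorProduct {k R Z : Type*} [Field k] [CommRing R] [IsDomain R]
    [Algebra k R] [Algebra.FiniteType k R] [CommRing Z] [Algebra k Z]
    (φ : R ≃+* Z ⊗[k] R) : IsField Z := by
  have : IsDomain (Z ⊗[k] R) := φ.symm.injective.isDomain
  have hinj : Function.Injective (algebraMap Z (Z ⊗[k] R)) :=
    Algebra.TensorProduct.includeLeft_injective (S := Z) (algebraMap k R).injective
  have : IsDomain Z := hinj.isDomain
  obtain ⟨s, g, hg, hint⟩ := exists_integral_inj_algHom_of_fg k R
  let G : Z ⊗[k] MvPolynomial (Fin s) k →ₐ[Z] Z ⊗[k] R :=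
    Algebra.TensorProduct.map (AlgHom.id Z Z) g
  have hG : Function.Injective G :=
    Module.Flat.lTensor_preserves_injective_linearMap (M := Z) g.toLinearMap hg
  have hGi : G.toRingHom.IsIntegral := by
    intro x
    induction x with
    | zero => exact G.toRingHom.isIntegralElem_zero
    | add x y hx hy => exact hx.add _ hy
    | tmul z r =>
      obtain ⟨p, hp, hpr⟩ := hint r
      have hr : G.toRingHom.IsIntegralElem (1 ⊗ₜ r) := by
        refine ⟨p.map (Algebra.TensorProduct.includeRight :
          MvPolynomial (Fin s) k →ₐ[k] Z ⊗[k] MvPolynomial (Fin s) k).toRingHom, hp.map _, ?_⟩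
        have hcomp : G.toRingHom.comp (Algebra.TensorProduct.includeRight :
            MvPolynomial (Fin s) k →ₐ[k] Z ⊗[k] MvPolynomial (Fin s) k).toRingHom =
            (Algebra.TensorProduct.includeRight : R →ₐ[k] Z ⊗[k] R).toRingHom.comp g.toRingHom :=
          RingHom.ext fun x => by simp [G]
        rw [Polynomial.eval₂_map, hcomp]
        have := congrArg (Algebra.TensorProduct.includeRight : R →ₐ[k] Z ⊗[k] R).toRingHom hpr
        rwa [Polynomial.hom_eval₂, map_zero] at this
      have hz : G.toRingHom.IsIntegralElem (z ⊗ₜ 1) := by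
        simpa [G] using G.toRingHom.isIntegralElem_map (x := z ⊗ₜ 1)
      simpa using hz.mul _ hr
  have h1 : ringKrullDim R = s := by
    algebraize [g.toRingHom]
    rw [ringKrullDim_eq_of_isIntegral_of_injective (MvPolynomial (Fin s) k) R hg,
      MvPolynomial.ringKrullDim_of_isNoetherianRing]
    simp
  have h2 : ringKrullDim R = ringKrullDim (MvPolynomial (Fin s) Z) := by
    rw [ringKrullDim_eq_of_ringEquiv φ]
    algebraize [G.toRingHom]
    rw [ringKrullDim_eq_of_isIntegral_of_injective (Z ⊗[k] MvPolynomial (Fin s) k) _ hG]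
    exact ringKrullDim_eq_of_ringEquiv (MvPolynomial.algebraTensorAlgEquiv k Z).toRingEquiv
  have h3 := ringKrullDim_add_natCard_le_ringKrullDim_mvPolynomial (R := Z) (Fin s)
  rw [← h2, h1, Nat.card_eq_fintype_card, Fintype.card_fin] at h3
  have h4 : ringKrullDim Z ≤ 0 := by
    have : (s : WithBot ℕ∞) ≠ ⊥ := WithBot.coe_ne_bot
    cases hd : ringKrullDim Z with
    | bot => exact bot_le
    | coe d =>
      rw [hd] at h3
      norm_cast at h3 ⊢
      exact (ENat.add_le_add_iff_right (ENat.natCast_ne_top s)).mp (h3.trans_eq (zero_add _).symm)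
  have : Ring.KrullDimLE 0 Z := Ring.krullDimLE_iff.mpr h4
  exact Ring.KrullDimLE.isField_of_isDomain

/-- A `k`-rational point of `R` gives a `Z`-rational point of `Z ⊗ R` under any ring isomorphism
`R ≃ Z ⊗ R`, even one that is not `k`-linear. -/
theorem bijective_quotientMk_comp_algebraMap {k R Z : Type*} [Field k] [CommRing R] [IsDomain R]
    [Algebra k R] [Algebra.FiniteType k R] [CommRing Z] [Algebra k Z]
    (I : Ideal R) (hI : Function.Bijective (algebraMap k (R ⧸ I))) (φ : R ≃+* Z ⊗[k] R) :
    Function.Bijective ((Ideal.Quotient.mk (I.map φ)).comp (algebraMap Z (Z ⊗[k] R))) := by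
  let := (isField_of_ringEquiv_tensorProduct φ).toField
  have : IsDomain (Z ⊗[k] R) := φ.symm.injective.isDomain
  let ε : R →ₐ[k] k := (AlgEquiv.ofBijective (Algebra.ofId k (R ⧸ I)) hI).symm.toAlgHom.comp
    (Ideal.Quotient.mkₐ k I)
  let π : Z ⊗[k] R →ₐ[Z] Z :=
    Algebra.TensorProduct.lift (AlgHom.id Z Z) ((Algebra.ofId k Z).comp ε) fun _ _ => .all _ _
  have hne : I.map φ ≠ ⊤ := by
    intro h
    have : I = ⊤ := by
      rw [← Ideal.comap_map_of_bijective φ φ.bijective (I := I), h, Ideal.comap_top]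
    have := hI.injective.nontrivial
    exact (Ideal.Quotient.nontrivial_iff.mp this) ‹I = ⊤›
  have : Nontrivial ((Z ⊗[k] R) ⧸ I.map φ) := Ideal.Quotient.nontrivial_iff.mpr hne
  refine ⟨RingHom.injective _, fun x => ?_⟩
  obtain ⟨x, rfl⟩ := Ideal.Quotient.mk_surjective x
  obtain ⟨r, rfl⟩ := φ.surjective x
  obtain ⟨c, hc⟩ := hI.surjective (Ideal.Quotient.mk I r)
  obtain ⟨z, hz⟩ := exists_algebraMap_eq_of_field_ringHom π
    ((φ : R →+* Z ⊗[k] R).comp (algebraMap k R)) c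
  refine ⟨z, ?_⟩
  rw [RingHom.comp_apply, hz, Ideal.Quotient.eq]
  rw [← Ideal.Quotient.mk_algebraMap, Ideal.Quotient.eq] at hc
  simpa using Ideal.mem_map_of_mem φ hc

section Morita

open CategoryTheory

namespace ModuleCat

variable {P : Type u} [Ring P]

/-- The natural action of a central element of a ring on all modules over it. -/
noncomputable def centerAction : Subring.center P →+* CatCenter (ModuleCat.{u} P) where
  toFun z :=
    { app M := ofHom
        { toFun m := (z : P) • m
          map_add' := smul_add _
          map_smul' r m := by
            simp only [RingHom.id_apply, smul_smul, Subring.mem_center_iff.mp z.2 r] }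
      naturality M N f := by
        ext m
        exact (f.hom.map_smul (z : P) m).symm }
  map_one' := by ext M m; exact one_smul P m
  map_zero' := by ext M m; exact zero_smul P m
  map_add' z w := by ext M m; exact add_smul (z : P) w m
  map_mul' z w := by ext M m; exact mul_smul (z : P) w m

@[simp]
theorem centerAction_app_apply (z : Subring.center P) (M : ModuleCat.{u} P) (m : M) :
    ((centerAction z).app M).hom m = (z : P) • m := rfl

theorem centerAction_bijective :
    Function.Bijective (centerAction : Subring.center P →+* CatCenter (ModuleCat.{u} P)) := by
  refine ⟨fun z w h => Subtype.ext ?_, fun η => ?_⟩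
  · have := congrArg (fun η : CatCenter (ModuleCat.{u} P) => (η.app (of P P)).hom (1 : P)) h
    exact (mul_one _).symm.trans (this.trans (mul_one _))
  · let c : P := (η.app (of P P)).hom (1 : P)
    have key (M : ModuleCat.{u} P) (m : M) : (η.app M).hom m = c • m := by
      have := congrArg (fun f => f.hom (1 : P))
        (η.naturality (ofHom (LinearMap.toSpanSingleton P M m) : of P P ⟶ M))
      simpa [c] using this
    have hc : c ∈ Subring.center P := by
      refine Subring.mem_center_iff.mpr fun r => ?_
      have h1 := key (of P P) r
      have h2 := (η.app (of P P)).hom.map_smul r (1 : P)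
      simp only [smul_eq_mul, mul_one] at h1 h2
      exact h2.symm.trans h1
    refine ⟨⟨c, hc⟩, ?_⟩
    ext M m
    exact (key M m).symm

end ModuleCat

namespace CategoryTheory.Equivalence
variable {C : Type*} {D : Type*} [Category* C] [Category* D] [Preadditive C] [Preadditive D]

/-- An additive equivalence of categories identifies their centers. -/
theorem exists_catCenter_ringEquiv (e : C ≌ D) [e.functor.Additive] :
    ∃ φ : CatCenter C ≃+* CatCenter D,
      ∀ (z : CatCenter C) (X : C), (φ z).app (e.functor.obj X) = e.functor.map (z.app X) := by
  have : e.functor.IsLocalization (MorphismProperty.isomorphisms C) :=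
    Functor.IsLocalization.of_isEquivalence _ _ le_rfl
  let f := CatCenter.localizationRingHom e.functor (MorphismProperty.isomorphisms C)
  have hf (z : CatCenter C) (X : C) : (f z).app (e.functor.obj X) = e.functor.map (z.app X) :=
    CatCenter.localization_app _ _ _ _
  refine ⟨RingEquiv.ofBijective f ⟨fun z w h => ?_, fun s => ?_⟩, hf⟩
  · ext X
    apply e.functor.map_injective
    rw [← hf, ← hf, h]
  · let r : CatCenter C :=
      { app X := e.functor.preimage (s.app (e.functor.obj X))
        naturality X Y g := by
          apply e.functor.map_injective
          simpa using s.naturality (e.functor.map g) }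
    exact ⟨r, CatCenter.ext_of_localization e.functor (MorphismProperty.isomorphisms C) _ _
      fun X => (hf r X).trans (e.functor.map_preimage _)⟩

end CategoryTheory.Equivalence

namespace ModuleCat

theorem restrictScalars_full_of_surjective {P P₀ : Type u} [Ring P] [Ring P₀] {α : P →+* P₀}
    (hα : Function.Surjective α) : (restrictScalars.{u} α).Full where
  map_surjective {M N} f := ⟨ofHom
    { toFun := f.hom
      map_add' := f.hom.map_add
      map_smul' r m := by
        obtain ⟨r, rfl⟩ := hα r
        exact f.hom.map_smul r m }, rfl⟩

theorem mem_essImage_restrictScalars_iff {P P₀ : Type u} [Ring P] [Ring P₀] {α : P →+* P₀}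
    (hα : Function.Surjective α) (M : ModuleCat.{u} P) :
    (restrictScalars.{u} α).essImage M ↔ RingHom.ker α ≤ Module.annihilator P M := by
  constructor
  · rintro ⟨N, ⟨i⟩⟩ r hr
    refine Module.mem_annihilator.mpr fun m => ?_
    obtain ⟨n, rfl⟩ := i.toLinearEquiv.surjective m
    rw [← map_smul, restrictScalars.smul_def α r n, (show α r = 0 from hr)]
    exact (congrArg _ (zero_smul P₀ (n : N))).trans (map_zero _)
  · intro h
    let : SMul P₀ M := ⟨fun r m => Function.surjInv hα r • m⟩
    have hsmul (r : P) (m : M) : α r • m = r • m := by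
      have hmem : Function.surjInv hα (α r) - r ∈ Module.annihilator P M :=
        h (by rw [RingHom.mem_ker, map_sub, Function.surjInv_eq hα, sub_self])
      rw [← sub_eq_zero]
      exact (sub_smul _ _ m).symm.trans (Module.mem_annihilator.mp hmem m)
    let : Module P₀ M := Function.Surjective.moduleLeft α hα hsmul
    let i : (restrictScalars α).obj (of P₀ M) ≃ₗ[P] M :=
      { AddEquiv.refl M with map_smul' := hsmul }
    exact ⟨of P₀ M, ⟨i.toModuleIso⟩⟩

end ModuleCat

/-- An equivalence of module categories induces an isomorphism of centers, and descends to
corresponding quotients by centrally generated ideals. -/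
theorem exists_center_ringEquiv_of_moduleCat_equivalence {P Q : Type u} [Ring P] [Ring Q]
    (e : ModuleCat.{u} P ≌ ModuleCat.{u} Q) :
    ∃ φ : Subring.center P ≃+* Subring.center Q,
      ∀ {P₀ Q₀ : Type u} [Ring P₀] [Ring Q₀] (α : P →+* P₀) (β : Q →+* Q₀)
        (J : Set (Subring.center P)), Function.Surjective α → Function.Surjective β →
        RingHom.ker α = Ideal.span ((↑) '' J) → RingHom.ker β = Ideal.span ((↑) '' (φ '' J)) →
        Nonempty (ModuleCat.{u} P₀ ≌ ModuleCat.{u} Q₀) := by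
  have : e.functor.Additive := e.functor.additive_of_preserves_binary_products
  obtain ⟨ψ, hψ⟩ := e.exists_catCenter_ringEquiv
  let cP := RingEquiv.ofBijective _ (ModuleCat.centerAction_bijective (P := P))
  let cQ := RingEquiv.ofBijective _ (ModuleCat.centerAction_bijective (P := Q))
  let φ : Subring.center P ≃+* Subring.center Q := (cP.trans ψ).trans cQ.symm
  have hφ (z : Subring.center P) (X : ModuleCat.{u} P) :
      (ModuleCat.centerAction (φ z)).app (e.functor.obj X) =
        e.functor.map ((ModuleCat.centerAction z).app X) := by
    rw [← hψ]
    exact congrArg (CatCenter.app · _) (cQ.apply_symm_apply (ψ (cP z)))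
  have hmem (R : Type u) [Ring R] (M : ModuleCat.{u} R) (z : Subring.center R) :
      (z : R) ∈ Module.annihilator R M ↔ (ModuleCat.centerAction z).app M = 0 := by
    rw [Module.mem_annihilator]
    exact ⟨fun h => by ext m; exact h m, fun h m => by
      rw [← ModuleCat.centerAction_app_apply, h]; rfl⟩
  refine ⟨φ, fun {P₀ Q₀} _ _ α β J hα hβ hkα hkβ => ?_⟩
  have := ModuleCat.restrictScalars_full_of_surjective hα
  have := ModuleCat.restrictScalars_full_of_surjective hβ
  let F := ModuleCat.restrictScalars.{u} α ⋙ e.functor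
  let G := ModuleCat.restrictScalars.{u} β
  have hFG : F.essImage = G.essImage := by
    ext N
    have hF : F.essImage N ↔ (ModuleCat.restrictScalars.{u} α).essImage (e.inverse.obj N) :=
      ⟨fun ⟨M, ⟨i⟩⟩ => ⟨M, ⟨(e.unitIso.app _).trans (e.inverse.mapIso i)⟩⟩,
        fun ⟨M, ⟨i⟩⟩ => ⟨M, ⟨(e.functor.mapIso i).trans (e.counitIso.app _)⟩⟩⟩
    have hz (z : Subring.center P) :
        (z : P) ∈ Module.annihilator P (e.inverse.obj N) ↔
          (φ z : Q) ∈ Module.annihilator Q N := by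
      have h : Module.annihilator Q (e.functor.obj (e.inverse.obj N)) = Module.annihilator Q N :=
        (e.counitIso.app N).toLinearEquiv.annihilator_eq
      rw [← h, hmem, hmem, hφ]
      exact e.functor.map_eq_zero_iff.symm
    rw [hF, ModuleCat.mem_essImage_restrictScalars_iff hα,
      ModuleCat.mem_essImage_restrictScalars_iff hβ, hkα, hkβ, Ideal.span_le, Ideal.span_le]
    simp only [Set.image_subset_iff]
    exact forall₂_congr fun z _ => hz z
  have hF : F.toEssImage.IsEquivalence := {}
  have hG : G.toEssImage.IsEquivalence := {}
  have hcongr : Nonempty (F.EssImageSubcategory ≌ G.EssImageSubcategory) := by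
    unfold Functor.EssImageSubcategory
    rw [hFG]
    exact ⟨.refl⟩
  exact hcongr.map fun E =>
    (F.toEssImage.asEquivalence.trans E).trans G.toEssImage.asEquivalence.symm

end Morita

section Center
variable {k : Type*} (B R : Type*) [Field k] [Ring B] [Algebra k B] [CommRing R] [Algebra k R]

/-- The center of `B ⊗ R` is `Z(B) ⊗ R` when `R` is commutative. -/
theorem exists_center_tensorProduct_ringEquiv :
    ∃ c : Subalgebra.center k B ⊗[k] R ≃+* Subring.center (B ⊗[k] R)ᵐᵒᵖ,
      ∀ d, (c d : (B ⊗[k] R)ᵐᵒᵖ) = MulOpposite.op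
        (Algebra.TensorProduct.map (Subalgebra.center k B).val (AlgHom.id k R) d) := by
  let i := Algebra.TensorProduct.map (Subalgebra.center k B).val (AlgHom.id k R)
  have hi : Function.Injective i :=
    Module.Flat.rTensor_preserves_injective_linearMap (M := R)
      (Subalgebra.center k B).val.toLinearMap Subtype.val_injective
  have hright (r : R) (x : B ⊗[k] R) : 1 ⊗ₜ[k] r * x = x * 1 ⊗ₜ[k] r := by
    induction x with
    | zero => simp
    | add y z hy hz => rw [mul_add, add_mul, hy, hz]
    | tmul c s => simp [mul_comm]
  have hr (x : B ⊗[k] R) : x ∈ Subring.center (B ⊗[k] R) ↔ x ∈ i.range := by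
    rw [← Subalgebra.centralizer_coe_range_includeLeft_eq_center_tensorProduct,
      Subring.mem_center_iff, Subalgebra.mem_centralizer_iff]
    refine ⟨fun h g _ => h g, fun h g => ?_⟩
    induction g with
    | zero => simp
    | add y z hy hz => rw [add_mul, mul_add, hy, hz]
    | tmul b r =>
      have hbr : b ⊗ₜ[k] r = b ⊗ₜ 1 * 1 ⊗ₜ[k] r := by simp
      have hb : b ⊗ₜ[k] 1 * x = x * b ⊗ₜ 1 := h _ ⟨b, rfl⟩
      rw [hbr, mul_assoc, hright, ← mul_assoc, hb, mul_assoc]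
  let j : Subalgebra.center k B ⊗[k] R →+* Subring.center (B ⊗[k] R) :=
    i.toRingHom.codRestrict (Subring.center (B ⊗[k] R)) fun d => (hr _).mpr ⟨d, rfl⟩
  refine ⟨(RingEquiv.ofBijective j ⟨fun x y h => hi (congrArg Subtype.val h), fun x => ?_⟩).trans
    Subring.centerToMulOpposite, fun _ => rfl⟩
  obtain ⟨d, hd⟩ := (hr x).mp x.2
  exact ⟨d, Subtype.ext hd⟩

open Algebra.TensorProduct in
/-- An ideal of `Z(B) ⊗ R` complementary to `Z(B)` generates an ideal of `B ⊗ R`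
complementary to `B`. -/
theorem exists_surjective_ker_eq_span_of_bijective (J : Ideal (Subalgebra.center k B ⊗[k] R))
    (hJ : Function.Bijective ((Ideal.Quotient.mk J).comp
      (algebraMap (Subalgebra.center k B) (Subalgebra.center k B ⊗[k] R)))) :
    ∃ β : B ⊗[k] R →+* B, Function.Surjective β ∧ RingHom.ker (RingHom.op β) =
      Ideal.span ((fun d => MulOpposite.op
        (map (Subalgebra.center k B).val (AlgHom.id k R) d)) '' J) := by
  let Z := Subalgebra.center k B
  let i := map Z.val (AlgHom.id k R)
  let E : Z ≃ₐ[Z] (Z ⊗[k] R) ⧸ J := AlgEquiv.ofBijective (Algebra.ofId Z _) hJ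
  let ψ : Z ⊗[k] R →ₐ[Z] Z := E.symm.toAlgHom.comp (Ideal.Quotient.mkₐ Z J)
  have hψ (d : Z ⊗[k] R) : ψ d = 0 ↔ d ∈ J := by
    rw [← Ideal.Quotient.eq_zero_iff_mem]
    exact map_eq_zero_iff E.symm E.symm.injective
  let ρ : R →ₐ[k] B := Z.val.comp ((ψ.restrictScalars k).comp includeRight)
  let β : B ⊗[k] R →ₐ[k] B := lift (AlgHom.id k B) ρ fun b r =>
    (Subalgebra.mem_center_iff.mp (ψ (1 ⊗ₜ r)).2 b)
  have hβ (b : B) (r : R) : β (b ⊗ₜ r) = b * (ψ (1 ⊗ₜ r) : Z) := lift_tmul _ _ _ _ _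
  have hβi (d : Z ⊗[k] R) : β (i d) = (ψ d : Z) := by
    induction d with
    | zero => simp
    | add x y hx hy => simp only [map_add, hx, hy]; rfl
    | tmul z r =>
      have hz : z ⊗ₜ[k] r = z • (1 ⊗ₜ[k] r : Z ⊗[k] R) := by simp [TensorProduct.smul_tmul']
      exact (hβ z r).trans (congrArg Subtype.val ((map_smul ψ z _).symm.trans (by rw [← hz])))
  refine ⟨β, fun b => ⟨b ⊗ₜ 1, ?_⟩, le_antisymm (fun x hx => ?_) (Ideal.span_le.mpr ?_)⟩
  · change β (b ⊗ₜ 1) = b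
    have h1 : ψ (1 ⊗ₜ 1) = 1 := map_one ψ
    rw [hβ, h1]
    exact mul_one b
  · have key (y : B ⊗[k] R) : MulOpposite.op (y - β y ⊗ₜ 1) ∈
        Ideal.span ((fun d => MulOpposite.op (i d)) '' J) := by
      induction y with
      | zero => simp
      | add y z hy hz =>
        convert add_mem hy hz using 1
        rw [← MulOpposite.op_add, map_add, TensorProduct.add_tmul]
        congr 1
        abel
      | tmul b r =>
        have hd : (1 ⊗ₜ r - ψ (1 ⊗ₜ r) ⊗ₜ 1 : Z ⊗[k] R) ∈ J := by
          rw [← hψ, map_sub, sub_eq_zero]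
          exact (ψ.commutes _).symm
        have hi : b ⊗ₜ[k] r - β (b ⊗ₜ r) ⊗ₜ 1 =
            i (1 ⊗ₜ r - ψ (1 ⊗ₜ r) ⊗ₜ 1) * b ⊗ₜ 1 := by
          have hz : b * (ψ (1 ⊗ₜ r) : Z) = (ψ (1 ⊗ₜ r) : Z) * b :=
            Subalgebra.mem_center_iff.mp (ψ (1 ⊗ₜ r)).2 b
          rw [hβ, hz, map_sub, sub_mul]
          simp [i, Z]
        rw [hi, MulOpposite.op_mul]
        exact Ideal.mul_mem_left _ _ (Ideal.subset_span ⟨_, hd, rfl⟩)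
    have h0 : β x.unop = 0 := congrArg MulOpposite.unop (RingHom.mem_ker.mp hx)
    simpa [h0] using key x.unop
  · rintro _ ⟨d, hd, rfl⟩
    refine congrArg MulOpposite.op ((hβi d).trans ?_)
    rw [(hψ d).mpr hd]
    rfl
end Center

/-- If the center of `A` is exactly the base field `k`, then `A` is
universally Morita cancellative. -/
theorem center_eq_base_field_implies_universally_Morita_cancellative
    (k A : Type u) [Field k] [Ring A] [Algebra k A]
    (hZ : Subalgebra.center k A = ⊥) :
    ∀ (R : Type u) [CommRing R] [IsDomain R] [Algebra k R] [Algebra.FiniteType k R]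
      (I : Ideal R), Function.Bijective (algebraMap k (R ⧸ I)) →
      ∀ (B : Type u) [Ring B] [Algebra k B],
        MoritaEquivalent (A ⊗[k] R) (B ⊗[k] R) → MoritaEquivalent A B := by
  intro R _ _ _ _ I hI B _ _ ⟨e⟩
  obtain ⟨φ, hφ⟩ := exists_center_ringEquiv_of_moduleCat_equivalence e
  obtain ⟨cA, hcA⟩ := exists_center_tensorProduct_ringEquiv (k := k) A R
  obtain ⟨cB, hcB⟩ := exists_center_tensorProduct_ringEquiv (k := k) B R
  let φ' := (cA.trans φ).trans cB.symm
  cases subsingleton_or_nontrivial A with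
  | inl hA =>
    have hD : Subsingleton (Subalgebra.center k A ⊗[k] R) :=
      (Algebra.TensorProduct.includeLeftRingHom :
        Subalgebra.center k A →+* Subalgebra.center k A ⊗[k] R).codomain_trivial
    have hE : Subsingleton (Subalgebra.center k B ⊗[k] R) := φ'.symm.injective.subsingleton
    have hB : Subsingleton B := by
      have h : Function.Injective (Algebra.TensorProduct.includeLeft :
          Subalgebra.center k B →ₐ[k] Subalgebra.center k B ⊗[k] R) :=
        Algebra.TensorProduct.includeLeft_injective (algebraMap k R).injective
      exact subsingleton_of_zero_eq_one (congrArg Subtype.val (h.subsingleton.elim 0 1))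
    let f : Aᵐᵒᵖ ≃+* Bᵐᵒᵖ :=
      { toFun _ := 0
        invFun _ := 0
        left_inv _ := Subsingleton.elim _ _
        right_inv _ := Subsingleton.elim _ _
        map_mul' _ _ := Subsingleton.elim _ _
        map_add' _ _ := Subsingleton.elim _ _ }
    exact ⟨(ModuleCat.restrictScalarsEquivalenceOfRingEquiv f).symm⟩
  | inr hA =>
    let ρ : R ≃+* Subalgebra.center k A ⊗[k] R :=
      ((Algebra.TensorProduct.congr ((Subalgebra.equivOfEq _ _ hZ).trans (Algebra.botEquiv k A))
        (AlgEquiv.refl : R ≃ₐ[k] R)).trans (Algebra.TensorProduct.lid k R)).symm.toRingEquiv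
    obtain ⟨α, hα, hkα⟩ := exists_surjective_ker_eq_span_of_bijective A R _
      (bijective_quotientMk_comp_algebraMap I hI ρ)
    obtain ⟨β, hβ, hkβ⟩ := exists_surjective_ker_eq_span_of_bijective B R _
      (bijective_quotientMk_comp_algebraMap I hI (ρ.trans φ'))
    refine hφ (RingHom.op α) (RingHom.op β) (cA '' (I.map ρ : Set _))
      (MulOpposite.op_surjective.comp (hα.comp MulOpposite.unop_surjective))
      (MulOpposite.op_surjective.comp (hβ.comp MulOpposite.unop_surjective)) ?_ ?_
    · rw [hkα, Set.image_image]
      simp only [hcA]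
    · have himg {S T : Type u} [CommRing S] [CommRing T] (f : S ≃+* T) (K : Ideal S) :
          (K.map f : Set T) = f '' K := by
        ext x
        exact Ideal.mem_map_of_equiv f x
      have hφ' (d) : φ (cA d) = cB (φ' d) := (cB.apply_symm_apply _).symm
      rw [hkβ, himg, himg]
      simp only [Set.image_image, RingEquiv.trans_apply, hφ', hcB]
end

section
/- Let A be a k-algebra with center Z. If Z is strongly retractable, or if Z/N(Z) is strongly retractable, then A is strongly cancellative. -/
open scoped TensorProduct

universe u

namespace MvPolynomial

/-- An algebra endomorphism of a polynomial ring that fixes the indeterminates modulo an ideal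
is the identity modulo that ideal. -/
theorem sub_mem_of_forall_X_sub_mem {σ S : Type*} [CommRing S]
    (ψ : MvPolynomial σ S →ₐ[S] MvPolynomial σ S) (J : Ideal (MvPolynomial σ S))
    (h : ∀ i, ψ (X i) - X i ∈ J) (p : MvPolynomial σ S) : ψ p - p ∈ J := by
  rw [← Ideal.Quotient.eq]
  have : (Ideal.Quotient.mkₐ S J).comp ψ = Ideal.Quotient.mkₐ S J :=
    algHom_ext fun i => by simpa using Ideal.Quotient.eq.2 (h i)
  exact congr($this p)

/-- A polynomial endomorphism over the base ring that moves each indeterminate by a nilpotent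
is bijective. -/
theorem bijective_of_isNilpotent_sub_X {σ S : Type*} [Finite σ] [CommRing S]
    (ψ : MvPolynomial σ S →ₐ[S] MvPolynomial σ S)
    (h : ∀ i, IsNilpotent (ψ (X i) - X i)) : Function.Bijective ψ := by
  classical
  have := Fintype.ofFinite σ
  let I : Ideal S :=
    Ideal.span ((Finset.univ.biUnion fun i => (ψ (X i) - X i).coeffs : Finset S) : Set S)
  have hIn : IsNilpotent I := by
    rw [Ideal.FG.isNilpotent_iff_le_nilradical ⟨_, rfl⟩, Ideal.span_le]
    intro a ha
    obtain ⟨i, -, hi⟩ := Finset.mem_biUnion.1 (Finset.mem_coe.1 ha)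
    obtain ⟨m, -, rfl⟩ := mem_coeffs_iff.1 hi
    exact isNilpotent_iff.1 (h i) m
  obtain ⟨N, hN⟩ := hIn
  have hX (i : σ) : ψ (X i) - X i ∈ I.map C := by
    rw [mem_map_C_iff]
    intro m
    by_cases hm : coeff m (ψ (X i) - X i) = 0
    · rw [hm]; exact I.zero_mem
    · refine Ideal.subset_span ?_
      simp only [Finset.coe_biUnion, Set.mem_iUnion]
      exact ⟨i, by simp, coeff_mem_coeffs m hm⟩
  have h0 (p : MvPolynomial σ S) : ψ p - p ∈ I.map C :=
    sub_mem_of_forall_X_sub_mem ψ _ hX p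
  set δ : Module.End S (MvPolynomial σ S) := ψ.toLinearMap - 1 with hδ
  have hδj (j : ℕ) (p : MvPolynomial σ S) (hp : p ∈ (I ^ j).map C) :
      δ p ∈ (I ^ (j + 1)).map C := by
    rw [p.as_sum, map_sum]
    refine sum_mem fun m _ => ?_
    have hm : δ (monomial m (coeff m p)) = C (coeff m p) * δ (monomial m 1) := by
      rw [← smul_eq_C_mul, ← map_smul, smul_monomial, smul_eq_mul, mul_one]
    rw [hm, pow_succ, Ideal.map_mul]
    exact Ideal.mul_mem_mul (Ideal.mem_map_of_mem _ (mem_map_C_iff.1 hp m)) (h0 _)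
  have hpow (j : ℕ) (p : MvPolynomial σ S) : (δ ^ j) p ∈ (I ^ j).map C := by
    induction j with
    | zero => simp [Ideal.one_eq_top, Ideal.map_top]
    | succ j ih => rw [pow_succ' δ]; exact hδj j _ ih
  have hnil : IsNilpotent δ := ⟨N, LinearMap.ext fun p => by simpa [hN] using hpow N p⟩
  have hu : IsUnit ψ.toLinearMap := by
    have := hnil.isUnit_one_add
    rwa [hδ, add_sub_cancel] at this
  exact (Module.End.isUnit_iff _).1 hu

/-- If an isomorphism of polynomial rings identifies the coefficient rings up to nilpotents, then
the images of the indeterminates are polynomial generators of the target. -/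
theorem bijective_aeval_of_isNilpotent {σ R S : Type*} [Finite σ] [CommRing R] [CommRing S]
    (φ : MvPolynomial σ R ≃+* MvPolynomial σ S)
    (hR : ∀ r, ∃ s, IsNilpotent (φ (C r) - C s))
    (hS : ∀ s, ∃ r, IsNilpotent (φ.symm (C s) - C r)) :
    Function.Bijective (aeval (R := S) fun i => φ (X i)) := by
  classical
  set θ : MvPolynomial σ S →ₐ[S] MvPolynomial σ S := aeval fun i => φ (X i) with hθ
  have hθX (i : σ) : θ (X i) = φ (X i) := aeval_X _ _
  have lift_mod (p : MvPolynomial σ R) : ∃ q, IsNilpotent (θ q - φ p) := by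
    simp only [← mem_nilradical, ← Ideal.Quotient.eq] at hR ⊢
    induction p using induction_on with
    | C r =>
      obtain ⟨s, hs⟩ := hR r
      exact ⟨C s, by rw [hs, ← algebraMap_eq, AlgHom.commutes]⟩
    | add p p' hp hp' =>
      obtain ⟨q, hq⟩ := hp
      obtain ⟨q', hq'⟩ := hp'
      exact ⟨q + q', by simp only [map_add, hq, hq']⟩
    | mul_X p i hp =>
      obtain ⟨q, hq⟩ := hp
      exact ⟨q * X i, by simp only [map_mul, hq, hθX]⟩
  have coeff_mod (q : MvPolynomial σ S) : ∃ p, IsNilpotent (θ q - φ p) ∧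
      ∀ m, IsNilpotent (φ.symm (C (coeff m q)) - C (coeff m p)) := by
    simp only [← mem_nilradical, ← Ideal.Quotient.eq] at hS ⊢
    induction q using induction_on with
    | C s =>
      obtain ⟨r, hr⟩ := hS s
      refine ⟨C r, ?_, fun m => ?_⟩
      · rw [Ideal.Quotient.eq, mem_nilradical] at hr ⊢
        rw [← algebraMap_eq, AlgHom.commutes, algebraMap_eq]
        simpa using hr.map φ
      · rw [coeff_C, coeff_C]
        split_ifs
        · exact hr
        · simp
    | add q q' hq hq' =>
      obtain ⟨p, hp, hc⟩ := hq
      obtain ⟨p', hp', hc'⟩ := hq'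
      exact ⟨p + p', by simp only [map_add, hp, hp'], fun m => by
        simp only [coeff_add, map_add, hc, hc']⟩
    | mul_X q i hq =>
      obtain ⟨p, hp, hc⟩ := hq
      refine ⟨p * X i, by simp only [map_mul, hp, hθX], fun m => ?_⟩
      rw [coeff_mul_X', coeff_mul_X']
      split_ifs
      · exact hc _
      · simp
  have nil_of_nil (q : MvPolynomial σ S) (hq : IsNilpotent (θ q)) : IsNilpotent q := by
    obtain ⟨p, hp, hc⟩ := coeff_mod q
    have hφp : IsNilpotent (φ p) := by
      rw [← mem_nilradical] at hp hq ⊢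
      exact (Submodule.sub_mem_iff_right _ hq).1 hp
    have hpn : IsNilpotent p := by simpa using hφp.map φ.symm
    rw [isNilpotent_iff] at hpn ⊢
    intro m
    have h1 : IsNilpotent (φ.symm (C (coeff m q))) := by
      have := hc m
      have h2 := (hpn m).map (C (σ := σ))
      rw [← mem_nilradical] at this h2 ⊢
      exact (Submodule.sub_mem_iff_left _ h2).1 this
    have h3 : IsNilpotent (C (coeff m q) : MvPolynomial σ S) := by simpa using h1.map φ
    simpa using isNilpotent_iff.1 h3 0
  choose g hg using fun i => lift_mod (φ.symm (X i))
  simp only [RingEquiv.apply_symm_apply] at hg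
  set τ : MvPolynomial σ S →ₐ[S] MvPolynomial σ S := aeval g with hτ
  have hτX (i : σ) : τ (X i) = g i := aeval_X _ _
  have hθτ : ∀ i, IsNilpotent ((θ.comp τ) (X i) - X i) := fun i => by
    simpa [hτX] using hg i
  have hmod (p : MvPolynomial σ S) : IsNilpotent (θ (τ p) - p) := by
    rw [← mem_nilradical]
    exact sub_mem_of_forall_X_sub_mem (θ.comp τ) _ (fun i => mem_nilradical.2 (hθτ i)) p
  have hτθ : ∀ i, IsNilpotent ((τ.comp θ) (X i) - X i) := fun i =>
    nil_of_nil _ (by simpa using hmod (θ (X i)))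
  have b1 := bijective_of_isNilpotent_sub_X _ hθτ
  have b2 := bijective_of_isNilpotent_sub_X _ hτθ
  rw [AlgHom.coe_comp] at b1 b2
  exact ⟨b2.1.of_comp, b1.2.of_comp⟩

end MvPolynomial

namespace PolyExt

section Hom

variable {k A R : Type u} [Field k] [Ring A] [Algebra k A] [Ring R] [Algebra k R] {n : ℕ}

/-- The homomorphism out of `A[t₁,…,tₙ]` with given restriction to `A` and given central values on
the indeterminates. -/
noncomputable def lift (f : A →ₐ[k] R) (c : Fin n → Subalgebra.center k R) :
    PolyExt A n →ₐ[k] R :=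
  AddMonoidAlgebra.liftNCAlgHom f
    (((Subalgebra.center k R).val.comp (MvPolynomial.aeval (R := k) c) :
        MvPolynomial (Fin n) k →* R).comp (MvPolynomial.monomialOneHom k (Fin n)))
    fun x _ => ((Subalgebra.mem_center_iff.1 (MvPolynomial.aeval (R := k) c _).2) (f x))

@[simp]
theorem lift_C (f : A →ₐ[k] R) (c : Fin n → Subalgebra.center k R) (a : A) :
    lift f c (C k A n a) = f a :=
  (AddMonoidAlgebra.liftNC_single _ _ _ _).trans (by simp)

@[simp]
theorem lift_X (f : A →ₐ[k] R) (c : Fin n → Subalgebra.center k R) (i : Fin n) :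
    lift f c (X A n i) = c i :=
  (AddMonoidAlgebra.liftNC_single _ _ _ _).trans <| by
    change f 1 * _ = _
    rw [map_one, one_mul]
    exact congrArg Subtype.val (MvPolynomial.aeval_X (R := k) c i)

theorem algHom_ext {f g : PolyExt A n →ₐ[k] R} (hC : ∀ a, f (C k A n a) = g (C k A n a))
    (hX : ∀ i, f (X A n i) = g (X A n i)) : f = g := by
  refine AlgHom.coe_ringHom_injective
    (AddMonoidAlgebra.ringHom_ext hC fun m => ?_)
  have : ((f : PolyExt A n →* R).comp (AddMonoidAlgebra.of A (Fin n →₀ ℕ))) =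
      ((g : PolyExt A n →* R).comp (AddMonoidAlgebra.of A (Fin n →₀ ℕ))) := by
    refine Finsupp.mulHom_ext' fun i => MonoidHom.ext_mnat ?_
    simpa using! hX i
  exact congr($this (.ofAdd m))

end Hom

section Center

variable (k A : Type u) [Field k] [Ring A] [Algebra k A] (n : ℕ)

/-- The inclusion of the polynomial ring over the center of `A` into `A[t₁,…,tₙ]`. -/
noncomputable def ofCenter :
    MvPolynomial (Fin n) (Subalgebra.center k A) →ₐ[k] PolyExt A n :=
  AddMonoidAlgebra.mapAlgHom (Fin n →₀ ℕ) (Subalgebra.center k A).val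

@[simp]
theorem ofCenter_monomial (m : Fin n →₀ ℕ) (z : Subalgebra.center k A) :
    ofCenter k A n (MvPolynomial.monomial m z) = AddMonoidAlgebra.single m (z : A) :=
  AddMonoidAlgebra.mapAlgHom_single _ _ _

@[simp]
theorem ofCenter_C (z : Subalgebra.center k A) :
    ofCenter k A n (MvPolynomial.C z) = C k A n z :=
  ofCenter_monomial k A n 0 z

@[simp]
theorem ofCenter_X (i : Fin n) : ofCenter k A n (MvPolynomial.X i) = X A n i :=
  ofCenter_monomial k A n _ 1

theorem coeff_ofCenter (p : MvPolynomial (Fin n) (Subalgebra.center k A)) (m : Fin n →₀ ℕ) :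
    (ofCenter k A n p).coeff m = ((MvPolynomial.coeff m p : Subalgebra.center k A) : A) :=
  AddMonoidAlgebra.coeff_mapAlgHom _ _ _

theorem ofCenter_injective : Function.Injective (ofCenter k A n) := fun p q h =>
  MvPolynomial.ext _ _ fun m => Subtype.ext <| by
    rw [← coeff_ofCenter, ← coeff_ofCenter, h]

theorem ofCenter_range : (ofCenter k A n).range = Subalgebra.center k (PolyExt A n) := by
  ext p
  rw [Subalgebra.mem_center_iff]
  constructor
  · rintro ⟨p, rfl⟩ q
    change q * ofCenter k A n p = ofCenter k A n p * q
    induction p using MvPolynomial.induction_on' with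
    | add p p' hp hp' => rw [map_add, mul_add, add_mul, hp, hp']
    | monomial m z =>
      rw [ofCenter_monomial]
      have : (AddMonoidHom.mulRight (AddMonoidAlgebra.single m (z : A))) =
          (AddMonoidHom.mulLeft (AddMonoidAlgebra.single m (z : A))) := by
        refine AddMonoidAlgebra.addMonoidHom_ext fun m' a => ?_
        simp [AddMonoidAlgebra.single_mul_single, add_comm,
          Subalgebra.mem_center_iff.1 z.2 a]
      exact congr($this q)
  · intro h
    have hc (m : Fin n →₀ ℕ) : p.coeff m ∈ Subalgebra.center k A := by
      rw [Subalgebra.mem_center_iff]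
      intro a
      have := congr(($(h (AddMonoidAlgebra.single 0 a))).coeff m)
      rwa [AddMonoidAlgebra.coeff_single_zero_mul, AddMonoidAlgebra.coeff_mul_single_zero] at this
    refine ⟨∑ m ∈ p.coeff.support, MvPolynomial.monomial m ⟨p.coeff m, hc m⟩, ?_⟩
    change ofCenter k A n _ = p
    rw [map_sum]
    simp only [ofCenter_monomial]
    exact AddMonoidAlgebra.sum_coeff_single p

variable {k A n} in
theorem ofCenter_mem_center (p : MvPolynomial (Fin n) (Subalgebra.center k A)) :
    ofCenter k A n p ∈ Subalgebra.center k (PolyExt A n) :=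
  ofCenter_range k A n ▸ ⟨p, rfl⟩

/-- The center of `A[t₁,…,tₙ]` is the polynomial ring over the center of `A`. -/
noncomputable def centerEquiv : MvPolynomial (Fin n) (Subalgebra.center k A) ≃ₐ[k]
    Subalgebra.center k (PolyExt A n) :=
  AlgEquiv.ofBijective ((ofCenter k A n).codRestrict _ ofCenter_mem_center)
    ⟨fun _ _ h => ofCenter_injective k A n congr(($h : PolyExt A n)), fun ⟨p, hp⟩ => by
      rw [← ofCenter_range] at hp
      obtain ⟨q, hq⟩ := hp
      exact ⟨q, Subtype.ext hq⟩⟩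

variable {k A n} {B : Type u} [Ring B] [Algebra k B]

/-- An isomorphism of polynomial extensions restricts to an isomorphism of the polynomial rings
over the centers. -/
theorem exists_ofCenter_equiv (φ : PolyExt A n ≃ₐ[k] PolyExt B n) :
    ∃ ψ : MvPolynomial (Fin n) (Subalgebra.center k A) ≃ₐ[k]
        MvPolynomial (Fin n) (Subalgebra.center k B),
      ∀ p, ofCenter k B n (ψ p) = φ (ofCenter k A n p) := by
  have hφ : (Subalgebra.center k (PolyExt A n)).map (φ : PolyExt A n →ₐ[k] PolyExt B n) =
      Subalgebra.center k (PolyExt B n) := by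
    ext q
    simp only [Subalgebra.mem_map, Subalgebra.mem_center_iff]
    constructor
    · rintro ⟨p, hp, rfl⟩ b
      obtain ⟨a, rfl⟩ := φ.surjective b
      simpa using congr(φ $(hp a))
    · intro h
      refine ⟨φ.symm q, fun a => φ.injective ?_, by simp⟩
      simpa using h (φ a)
  let e := ((centerEquiv k A n).trans (φ.subalgebraMap _)).trans
    ((Subalgebra.equivOfEq _ _ hφ).trans (centerEquiv k B n).symm)
  refine ⟨e, fun p => ?_⟩
  have : (centerEquiv k B n (e p) : PolyExt B n) = φ (ofCenter k A n p) := by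
    simp only [e, AlgEquiv.trans_apply, AlgEquiv.apply_symm_apply]
    rfl
  exact this

end Center

variable {k A B : Type u} [Field k] [Ring A] [Algebra k A] [Ring B] [Algebra k B] {n : ℕ}

/-- An isomorphism of polynomial extensions matching the indeterminates induces an isomorphism of
the coefficient algebras. -/
theorem nonempty_algEquiv_of_map_X (e : PolyExt A n ≃ₐ[k] PolyExt B n)
    (he : ∀ i, e (X A n i) = X B n i) : Nonempty (A ≃ₐ[k] B) := by
  have he' (i : Fin n) : e.symm (X B n i) = X A n i := by rw [← he, e.symm_apply_apply]
  let εA : PolyExt A n →ₐ[k] A := lift (AlgHom.id k A) 0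
  let εB : PolyExt B n →ₐ[k] B := lift (AlgHom.id k B) 0
  let α : A →ₐ[k] B := (εB.comp e).comp (C k A n)
  let β : B →ₐ[k] A := (εA.comp e.symm).comp (C k B n)
  have hα : εB.comp e = α.comp εA := algHom_ext (by simp [α, εA]) (by simp [εA, εB, he])
  have hβ : εA.comp e.symm = β.comp εB := algHom_ext (by simp [β, εB]) (by simp [εA, εB, he'])
  refine ⟨AlgEquiv.ofAlgHom α β (AlgHom.ext fun b => ?_) (AlgHom.ext fun a => ?_)⟩
  · have := congr($hα (e.symm (C k B n b)))
    simpa [εB, β] using this.symm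
  · have := congr($hβ (e (C k A n a)))
    simpa [εA, α] using this.symm

/-- The endomorphism of `B[t₁,…,tₙ]` over `B` extending an endomorphism of the polynomial ring over
the center of `B`. -/
noncomputable def extendEnd
    (h : MvPolynomial (Fin n) (Subalgebra.center k B) →ₐ[Subalgebra.center k B]
      MvPolynomial (Fin n) (Subalgebra.center k B)) : PolyExt B n →ₐ[k] PolyExt B n :=
  lift (C k B n) fun i => ⟨_, ofCenter_mem_center (h (MvPolynomial.X i))⟩

theorem extendEnd_C (h : MvPolynomial (Fin n) (Subalgebra.center k B) →ₐ[Subalgebra.center k B]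
    MvPolynomial (Fin n) (Subalgebra.center k B)) (b : B) :
    extendEnd h (C k B n b) = C k B n b :=
  lift_C _ _ _

theorem extendEnd_X (h : MvPolynomial (Fin n) (Subalgebra.center k B) →ₐ[Subalgebra.center k B]
    MvPolynomial (Fin n) (Subalgebra.center k B)) (i : Fin n) :
    extendEnd h (X B n i) = ofCenter k B n (h (MvPolynomial.X i)) :=
  lift_X _ _ _

theorem extendEnd_ofCenter
    (h : MvPolynomial (Fin n) (Subalgebra.center k B) →ₐ[Subalgebra.center k B]
      MvPolynomial (Fin n) (Subalgebra.center k B))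
    (p : MvPolynomial (Fin n) (Subalgebra.center k B)) :
    extendEnd h (ofCenter k B n p) = ofCenter k B n (h p) := by
  induction p using MvPolynomial.induction_on with
  | C z =>
    rw [← MvPolynomial.algebraMap_eq, AlgHom.commutes, MvPolynomial.algebraMap_eq, ofCenter_C,
      extendEnd_C]
  | add p q hp hq => simp only [map_add, hp, hq]
  | mul_X p i hp => simp only [map_mul, hp, ofCenter_X, extendEnd_X]

theorem extendEnd_comp_eq_id
    {g h : MvPolynomial (Fin n) (Subalgebra.center k B) →ₐ[Subalgebra.center k B]
      MvPolynomial (Fin n) (Subalgebra.center k B)}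
    (hgh : ∀ p, g (h p) = p) : (extendEnd g).comp (extendEnd h) = AlgHom.id k _ :=
  algHom_ext (fun b => by simp only [AlgHom.comp_apply, extendEnd_C, AlgHom.id_apply])
    fun i => by
      rw [AlgHom.comp_apply, extendEnd_X, extendEnd_ofCenter, hgh, ofCenter_X, AlgHom.id_apply]

/-- If the images of the indeterminates are polynomial generators over the center of `B`, then the
coefficient algebras are isomorphic. -/
theorem nonempty_algEquiv_of_bijective_aeval (φ : PolyExt A n ≃ₐ[k] PolyExt B n)
    (f : Fin n → MvPolynomial (Fin n) (Subalgebra.center k B))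
    (hf : ∀ i, ofCenter k B n (f i) = φ (X A n i))
    (hbij : Function.Bijective (MvPolynomial.aeval (R := Subalgebra.center k B) f)) :
    Nonempty (A ≃ₐ[k] B) := by
  let θ₀ := AlgEquiv.ofBijective _ hbij
  have hθ₀ (i : Fin n) : θ₀ (MvPolynomial.X i) = f i := MvPolynomial.aeval_X _ _
  let θ : PolyExt B n ≃ₐ[k] PolyExt B n :=
    AlgEquiv.ofAlgHom (extendEnd θ₀.toAlgHom) (extendEnd θ₀.symm.toAlgHom)
      (extendEnd_comp_eq_id θ₀.apply_symm_apply) (extendEnd_comp_eq_id θ₀.symm_apply_apply)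
  refine nonempty_algEquiv_of_map_X (φ.trans θ.symm) fun i => ?_
  rw [AlgEquiv.trans_apply, AlgEquiv.symm_apply_eq, ← hf, ← hθ₀]
  exact (extendEnd_X θ₀.toAlgHom i).symm

end PolyExt

/-- An isomorphism of polynomial rings maps a strongly retractable coefficient ring into the
target coefficient ring. -/
theorem StronglyRetractable.exists_eq_C {k R S : Type u} [Field k] [CommRing R] [Algebra k R]
    [CommRing S] [Algebra k S] (h : StronglyRetractable k R) {n : ℕ} (hn : 1 ≤ n)
    (φ : MvPolynomial (Fin n) R ≃ₐ[k] MvPolynomial (Fin n) S) :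
    (∀ r, ∃ s, φ (MvPolynomial.C r) = MvPolynomial.C s) ∧
      ∀ s, ∃ r, φ.symm (MvPolynomial.C s) = MvPolynomial.C r := by
  have key := h n hn S φ
  refine ⟨fun r => ?_, fun s => ?_⟩
  · obtain ⟨s, hs⟩ := key.subset ⟨_, ⟨r, rfl⟩, rfl⟩
    exact ⟨s, hs.symm⟩
  · obtain ⟨_, ⟨r, rfl⟩, hr⟩ := key.superset ⟨s, rfl⟩
    exact ⟨r, (AlgEquiv.symm_apply_eq _).2 hr.symm⟩

theorem MvPolynomial.ker_mapAlgHom_mk_nilradical {σ k R : Type*} [Field k] [CommRing R]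
    [Algebra k R] : RingHom.ker (mapAlgHom (σ := σ) (Ideal.Quotient.mkₐ k (nilradical R))) =
      nilradical (MvPolynomial σ R) := by
  ext p
  rw [mem_nilradical, isNilpotent_iff, RingHom.mem_ker, MvPolynomial.ext_iff]
  simp [coeff_map, Ideal.Quotient.eq_zero_iff_mem, mem_nilradical]

theorem MvPolynomial.mapAlgHom_mk_nilradical_eq_iff {σ k R : Type*} [Field k] [CommRing R]
    [Algebra k R] {p q : MvPolynomial σ R} :
    mapAlgHom (Ideal.Quotient.mkₐ k (nilradical R)) p =
      mapAlgHom (Ideal.Quotient.mkₐ k (nilradical R)) q ↔ IsNilpotent (p - q) := by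
  rw [← mem_nilradical, ← ker_mapAlgHom_mk_nilradical (k := k), RingHom.mem_ker, map_sub,
    sub_eq_zero]

/-- An isomorphism of polynomial rings descends to the reductions of the coefficient rings. -/
theorem MvPolynomial.exists_algEquiv_quotient_nilradical {σ k R S : Type*} [Field k] [CommRing R]
    [Algebra k R] [CommRing S] [Algebra k S] (φ : MvPolynomial σ R ≃ₐ[k] MvPolynomial σ S) :
    ∃ ψ : MvPolynomial σ (R ⧸ nilradical R) ≃ₐ[k] MvPolynomial σ (S ⧸ nilradical S),
      ∀ p, ψ (mapAlgHom (Ideal.Quotient.mkₐ k (nilradical R)) p) =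
        mapAlgHom (Ideal.Quotient.mkₐ k (nilradical S)) (φ p) := by
  set qR := mapAlgHom (σ := σ) (Ideal.Quotient.mkₐ k (nilradical R))
  set qS := mapAlgHom (σ := σ) (Ideal.Quotient.mkₐ k (nilradical S))
  have hR : Function.Surjective qR := map_surjective _ (Ideal.Quotient.mk_surjective)
  have hS : Function.Surjective qS := map_surjective _ (Ideal.Quotient.mk_surjective)
  have hker : RingHom.ker qR = RingHom.ker (qS.comp (φ : _ →ₐ[k] MvPolynomial σ S)) := by
    ext p
    have := RingHom.mem_ker (f := qS) (r := φ p)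
    rw [ker_mapAlgHom_mk_nilradical, mem_nilradical] at this ⊢
    rw [RingHom.mem_ker, AlgHom.comp_apply]
    exact Iff.trans ⟨fun h => h.map φ, fun h => by simpa using h.map φ.symm⟩ this
  refine ⟨(Ideal.quotientKerAlgEquivOfSurjective hR).symm.trans
    ((Ideal.quotientEquivAlgOfEq k hker).trans
      (Ideal.quotientKerAlgEquivOfSurjective (hS.comp φ.surjective))), fun p => ?_⟩
  simp only [AlgEquiv.trans_apply, Ideal.quotientKerAlgEquivOfSurjective_symm_apply]
  rfl

/-- If `R` or its reduction is strongly retractable, then isomorphisms of polynomial rings preserve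
the coefficient rings up to nilpotents. -/
theorem MvPolynomial.exists_isNilpotent_sub_C {k R S : Type u} [Field k] [CommRing R] [Algebra k R]
    [CommRing S] [Algebra k S]
    (h : StronglyRetractable k R ∨ StronglyRetractable k (R ⧸ nilradical R)) {n : ℕ} (hn : 1 ≤ n)
    (φ : MvPolynomial (Fin n) R ≃ₐ[k] MvPolynomial (Fin n) S) :
    (∀ r, ∃ s, IsNilpotent (φ (C r) - C s)) ∧ ∀ s, ∃ r, IsNilpotent (φ.symm (C s) - C r) := by
  rcases h with h | h
  · obtain ⟨h₁, h₂⟩ := h.exists_eq_C hn φ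
    refine ⟨fun r => ?_, fun s => ?_⟩
    · obtain ⟨s, hs⟩ := h₁ r
      exact ⟨s, by simp [hs]⟩
    · obtain ⟨r, hr⟩ := h₂ s
      exact ⟨r, by simp [hr]⟩
  · obtain ⟨χ, hχ⟩ := exists_algEquiv_quotient_nilradical φ
    obtain ⟨h₁, h₂⟩ := h.exists_eq_C hn χ
    refine ⟨fun r => ?_, fun s => ?_⟩
    · obtain ⟨s, hs⟩ := h₁ (Ideal.Quotient.mk _ r)
      obtain ⟨s, rfl⟩ := Ideal.Quotient.mk_surjective s
      refine ⟨s, (mapAlgHom_mk_nilradical_eq_iff (k := k)).1 ?_⟩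
      rw [← hχ]
      simpa using hs
    · obtain ⟨r, hr⟩ := h₂ (Ideal.Quotient.mk _ s)
      obtain ⟨r, rfl⟩ := Ideal.Quotient.mk_surjective r
      refine ⟨r, (mapAlgHom_mk_nilradical_eq_iff (k := k)).1 (χ.injective ?_)⟩
      rw [hχ, φ.apply_symm_apply]
      simpa using (AlgEquiv.symm_apply_eq _).1 hr

/-- If the center `Z` of `A`, or `Z/N(Z)`, is strongly retractable,
then `A` is strongly cancellative. -/
theorem strongly_cancellative_of_center_strongly_retractable
    (k A : Type u) [Field k] [Ring A] [Algebra k A]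
    (h : StronglyRetractable k (Subalgebra.center k A) ∨
      StronglyRetractable k
        ((Subalgebra.center k A) ⧸ nilradical (Subalgebra.center k A))) :
    StronglyCancellative k A := by
  rintro n hn B _ _ ⟨φ⟩
  obtain ⟨ψ, hψ⟩ := PolyExt.exists_ofCenter_equiv φ
  have hnil := MvPolynomial.exists_isNilpotent_sub_C h hn ψ
  refine PolyExt.nonempty_algEquiv_of_bijective_aeval φ (fun i => ψ (MvPolynomial.X i))
    (fun i => by rw [hψ, PolyExt.ofCenter_X]) ?_
  exact MvPolynomial.bijective_aeval_of_isNilpotent ψ.toRingEquiv hnil.1 hnil.2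
end
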